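/- Let G be a finite group whose prime graph on real class sizes has two connected components with vertex sets π₁ and π₂, where 2 ∉ π₂. Then there exists an involution i ∈ G such that |i^G| > 1 is a π₂-number (all prime divisors of |i^G| lie in π₂) and the centralizer C_G(i) has a normal Sylow 2-subgroup. -/

import Mathlib

/-- An element `x` of a group is *real* if it is conjugate to its inverse. -/
def IsRealEl (G : Type*) [Group G] (x : G) : Prop := ∃ g : G, g⁻¹ * x * g = x⁻¹

/-- The size of the conjugacy class of `x` in `G`. -/
noncomputable def clSize (G : Type*) [Group G] (x : G) : ℕ := Nat.card {y : G // IsConj x y}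

/-- Vertices of the prime graph on real class sizes. -/
def realVerts (G : Type*) [Group G] : Set ℕ :=
  {p | p.Prime ∧ ∃ x : G, IsRealEl G x ∧ p ∣ clSize G x}

/-- Adjacency in the prime graph on real class sizes. -/
def realAdj (G : Type*) [Group G] (p q : ℕ) : Prop :=
  p.Prime ∧ q.Prime ∧ p ≠ q ∧ ∃ x : G, IsRealEl G x ∧ p * q ∣ clSize G x

/-- The prime graph on real class sizes is disconnected. -/
def realDisconnected (G : Type*) [Group G] : Prop :=
  ∃ π₁ π₂ : Set ℕ, π₁.Nonempty ∧ π₂.Nonempty ∧ Disjoint π₁ π₂ ∧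
    π₁ ∪ π₂ = realVerts G ∧ ∀ p ∈ π₁, ∀ q ∈ π₂, ¬ realAdj G p q

open Subgroup

/-- In a finite `p`-group `P`, a proper subset `E` of `D ∩ P` (with `D` conjugation invariant)
that is cut out of `D` by the subgroup it generates is normalized by some element of `D ∩ P`
outside `E`. -/
lemma exists_mem_normalizer_closure_of_ssubset {G : Type*} [Group G] [Finite G] {p : ℕ}
    [Fact p.Prime] {P : Subgroup G} (hP : IsPGroup p P) {D E : Set G}
    (hD : ∀ g, ∀ d ∈ D, g * d * g⁻¹ ∈ D) (hE : E ⊆ D ∩ P) {w : G} (hwD : w ∈ D) (hwP : w ∈ P)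
    (hwE : w ∉ E) :
    ∃ u ∈ D, u ∈ P ∧ u ∉ E ∧ u ∈ normalizer (closure E : Set G) := by
  by_contra! hcon
  set M : Subgroup G := P ⊓ normalizer (closure E : Set G) with hM
  have hEM : ∀ d, d ∈ E ↔ d ∈ D ∧ d ∈ M := fun d =>
    ⟨fun h => ⟨(hE h).1, (hE h).2, le_normalizer (subset_closure h)⟩,
      fun h => by_contra fun hd => hcon d h.1 h.2.1 hd h.2.2⟩
  have hlt : M.subgroupOf P < ⊤ := by
    rw [lt_top_iff_ne_top, Ne, subgroupOf_eq_top]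
    exact fun h => hwE ((hEM w).2 ⟨hwD, h hwP⟩)
  have hnil : Group.IsNilpotent P := hP.isNilpotent
  obtain ⟨g, hgN, hgM⟩ := SetLike.exists_of_lt
    (Group.normalizerCondition_of_isNilpotent (G := P) _ hlt)
  refine hgM (mem_subgroupOf.2 ⟨g.2, normalizer_le_normalizer_closure E fun d => ?_⟩)
  rw [hEM, hEM]
  rw [← subgroupOf_normalizer_eq inf_le_left, mem_subgroupOf, mem_normalizer_iff] at hgN
  have hDg : d ∈ D ↔ (g : G) * d * (g : G)⁻¹ ∈ D :=
    ⟨hD _ _, fun h => by simpa [mul_assoc] using hD (g : G)⁻¹ _ h⟩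
  rw [hDg, hgN]

/-- Two involutions whose product has `2`-power order generate a `2`-group. -/
lemma isPGroup_zpowers_sup_zpowers {G : Type*} [Group G] {u v : G} (hu : u ^ 2 = 1)
    (hv : v ^ 2 = 1) (huv : ∃ k, (u * v) ^ 2 ^ k = 1) :
    IsPGroup 2 (zpowers u ⊔ zpowers v : Subgroup G) := by
  have hz : ∀ x : G, (∃ k, x ^ 2 ^ k = 1) → IsPGroup 2 (zpowers x) := by
    rintro x ⟨k, hk⟩
    refine IsPGroup.of_card_dvd_pow (n := k) ?_
    rw [Nat.card_zpowers]
    exact orderOf_dvd_of_pow_eq_one hk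
  have hu' : u * u = 1 := by rw [← sq, hu]
  have hui : u⁻¹ = u := inv_eq_of_mul_eq_one_left hu'
  have hvi : v⁻¹ = v := inv_eq_of_mul_eq_one_left (by rw [← sq, hv])
  have hconj : u * (u * v) * u⁻¹ = (u * v)⁻¹ := by
    rw [mul_inv_rev, hui, hvi, ← mul_assoc, hu', one_mul]
  have hN : zpowers u ≤ normalizer (zpowers (u * v) : Set G) := by
    rw [zpowers_le, mem_normalizer_iff_map_conj_eq, MonoidHom.map_zpowers]
    rw [MonoidHom.coe_coe, MulAut.conj_apply, hconj, zpowers_inv]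
  have h := (hz u ⟨1, by simpa using hu⟩).to_sup_of_normal_right' (hz _ huv) hN
  refine h.to_le (sup_le le_sup_left ?_)
  rw [zpowers_le]
  have hmem := mul_mem (mem_sup_left (T := zpowers (u * v)) (mem_zpowers u))
    (mem_sup_right (mem_zpowers (u * v)))
  rwa [← mul_assoc, hu', one_mul] at hmem

/-- If any two involutions have a product of `2`-power order, then every involution lies in every
Sylow `2`-subgroup. -/
lemma mem_sylow_of_sq_eq_one {G : Type*} [Group G] [Finite G]
    (h : ∀ u v : G, u ^ 2 = 1 → v ^ 2 = 1 → ∃ k, (u * v) ^ 2 ^ k = 1)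
    {t : G} (ht : t ^ 2 = 1) (Q : Sylow 2 G) : t ∈ Q := by
  set D : Set G := {t | t ^ 2 = 1} with hDdef
  have hD : ∀ g, ∀ d ∈ D, g * d * g⁻¹ ∈ D := by
    intro g d hd
    simp only [hDdef, Set.mem_ofPred_eq] at hd ⊢
    rw [conj_pow, hd]; simp
  have hcard : ∀ P Q : Sylow 2 G, (D ∩ (P : Set G)).ncard = (D ∩ (Q : Set G)).ncard := by
    have hle : ∀ P Q : Sylow 2 G, (D ∩ (P : Set G)).ncard ≤ (D ∩ (Q : Set G)).ncard := by
      intro P Q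
      obtain ⟨g, rfl⟩ := MulAction.exists_smul_eq G P Q
      refine Set.ncard_le_ncard_of_injOn (fun x => g * x * g⁻¹) ?_ ?_ (Set.toFinite _)
      · rintro x ⟨hx, hxP⟩
        refine ⟨hD g x hx, ?_⟩
        rw [Sylow.coe_smul]
        exact ⟨x, hxP, rfl⟩
      · intro x _ y _ hxy
        simpa using hxy
    exact fun P Q => le_antisymm (hle P Q) (hle Q P)
  have key : ∀ n, ∀ P Q : Sylow 2 G, D.ncard - (D ∩ ((P : Set G) ∩ Q)).ncard = n →
      D ∩ (P : Set G) ⊆ Q := by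
    intro n
    induction n using Nat.strong_induction_on with
    | _ n ih =>
      intro P Q hn
      set E : Set G := D ∩ ((P : Set G) ∩ Q) with hEdef
      have step : ∀ A B : Sylow 2 G, E ⊆ D ∩ ((A : Set G) ∩ B) → ∀ x ∈ D, x ∈ A → x ∈ B →
          x ∉ E → D ∩ (A : Set G) ⊆ B := by
        intro A B hEAB x hxD hxA hxB hxE
        refine ih _ ?_ A B rfl
        have h1 : E.ncard < (D ∩ ((A : Set G) ∩ B)).ncard :=
          Set.ncard_lt_ncard ⟨hEAB, fun hs => hxE (hs ⟨hxD, hxA, hxB⟩)⟩ (Set.toFinite _)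
        have h2 : (D ∩ ((A : Set G) ∩ B)).ncard ≤ D.ncard :=
          Set.ncard_le_ncard Set.inter_subset_left (Set.toFinite _)
        omega
      by_contra hPQ
      have hQP : ¬ D ∩ (Q : Set G) ⊆ P := by
        intro hs
        have := Set.eq_of_subset_of_ncard_le (s := D ∩ (Q : Set G)) (t := D ∩ (P : Set G))
          (fun x hx => ⟨hx.1, hs hx⟩) (hcard P Q).le (Set.toFinite _)
        exact hPQ (this ▸ Set.inter_subset_right)
      obtain ⟨w, ⟨hwD, hwP⟩, hwQ⟩ := Set.not_subset.1 hPQ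
      obtain ⟨w', ⟨hwD', hwQ'⟩, hwP'⟩ := Set.not_subset.1 hQP
      obtain ⟨u, huD, huP, huE, huN⟩ := exists_mem_normalizer_closure_of_ssubset P.2 hD
        (E := E) (fun x hx => ⟨hx.1, hx.2.1⟩) hwD hwP (fun hx => hwQ hx.2.2)
      obtain ⟨v, hvD, hvQ, hvE, hvN⟩ := exists_mem_normalizer_closure_of_ssubset Q.2 hD
        (E := E) (fun x hx => ⟨hx.1, hx.2.2⟩) hwD' hwQ' (fun hx => hwP' hx.2.1)
      have hR : IsPGroup 2 (closure E) := P.2.to_le ((closure_le _).2 fun x hx => hx.2.1)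
      have hS := (isPGroup_zpowers_sup_zpowers huD hvD (h u v huD hvD)).to_sup_of_normal_right' hR
        (sup_le (zpowers_le.2 huN) (zpowers_le.2 hvN))
      obtain ⟨T, hT⟩ := hS.exists_le_sylow
      have hET : E ⊆ T := fun x hx => hT (mem_sup_right (subset_closure hx))
      have huT : u ∈ T := hT (mem_sup_left (mem_sup_left (mem_zpowers u)))
      have hvT : v ∈ T := hT (mem_sup_left (mem_sup_right (mem_zpowers v)))
      have hPT := step P T (fun x hx => ⟨hx.1, hx.2.1, hET hx⟩) u huD huP huT huE
      have hTQ := step T Q (fun x hx => ⟨hx.1, hET hx, hx.2.2⟩) v hvD hvT hvQ hvE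
      exact hPQ fun x hx => hTQ ⟨hx.1, hPT hx⟩
  have hzt : IsPGroup 2 (zpowers t) := by
    refine IsPGroup.of_card_dvd_pow (n := 1) ?_
    rw [Nat.card_zpowers]
    exact orderOf_dvd_of_pow_eq_one (by simpa using ht)
  obtain ⟨P, hP⟩ := hzt.exists_le_sylow
  exact key _ P Q rfl ⟨ht, hP (mem_zpowers t)⟩

/-- Elements of `p`-power order with the same image under a homomorphism whose kernel has no
element of order divisible by `p` are conjugate. -/
lemma exists_conj_eq_of_map_eq {H Q : Type*} [Group H] [Finite H] [Group Q] (f : H →* Q) {p : ℕ}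
    [hp : Fact p.Prime] (hker : ∀ x ∈ f.ker, ∀ k, x ^ p ^ k = 1 → x = 1) {a b : H} {m n : ℕ}
    (ha : a ^ p ^ m = 1) (hb : b ^ p ^ n = 1) (hab : f a = f b) : ∃ k : H, k * b * k⁻¹ = a := by
  set K : Subgroup H := (centralizer {f a}).comap f with hK
  have haK : a ∈ K := by simp [hK, mem_centralizer_singleton_iff]
  have hbK : b ∈ K := by simp [hK, mem_centralizer_singleton_iff, hab]
  have hz : ∀ (x : K) (l : ℕ), x ^ p ^ l = 1 → IsPGroup p (zpowers x) := by
    intro x l hl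
    refine IsPGroup.of_card_dvd_pow (n := l) ?_
    rw [Nat.card_zpowers]
    exact orderOf_dvd_of_pow_eq_one hl
  obtain ⟨A, hA⟩ := (hz ⟨a, haK⟩ m (Subtype.ext (by simpa using ha))).exists_le_sylow
  obtain ⟨B, hB⟩ := (hz ⟨b, hbK⟩ n (Subtype.ext (by simpa using hb))).exists_le_sylow
  obtain ⟨k, rfl⟩ := MulAction.exists_smul_eq K B A
  refine ⟨k, ?_⟩
  have h1 : k * ⟨b, hbK⟩ * k⁻¹ ∈ k • B := by
    rw [← SetLike.mem_coe, Sylow.coe_smul]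
    exact ⟨_, hB (mem_zpowers _), rfl⟩
  have h2 : k * ⟨b, hbK⟩ * k⁻¹ * ⟨a, haK⟩⁻¹ ∈ k • B := mul_mem h1 (inv_mem (hA (mem_zpowers _)))
  obtain ⟨l, hl⟩ := (k • B).2 ⟨_, h2⟩
  have hl' : ((k : H) * b * (k : H)⁻¹ * a⁻¹) ^ p ^ l = 1 := by
    have := congrArg (fun x : (k • B : Sylow p K) => ((x : K) : H)) hl
    simpa using this
  refine mul_inv_eq_one.1 (hker _ ?_ l hl')
  have hk : f k * f a = f a * f k := mem_centralizer_singleton_iff.1 k.2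
  rw [MonoidHom.mem_ker]
  simp only [map_mul, map_inv, ← hab, hk]
  group

/-- The property that `1` is the only real element of odd prime power order. -/
def NoOddReal (H : Type*) [Group H] : Prop :=
  ∀ p : ℕ, p.Prime → p ≠ 2 → ∀ x : H, IsRealEl H x → ∀ k, x ^ p ^ k = 1 → x = 1

lemma IsRealEl.pow {H : Type*} [Group H] {x : H} (hx : IsRealEl H x) (n : ℕ) :
    IsRealEl H (x ^ n) := by
  obtain ⟨g, hg⟩ := hx
  refine ⟨g, ?_⟩
  have := conj_pow (i := n) (a := g⁻¹) (b := x)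
  rw [inv_inv] at this
  rw [← this, hg, inv_pow]

lemma NoOddReal.exists_pow_two_pow_eq_one {H : Type*} [Group H] [Finite H] (h : NoOddReal H)
    {x : H} (hx : IsRealEl H x) : ∃ k, x ^ 2 ^ k = 1 := by
  refine ⟨(orderOf x).factorization 2, ?_⟩
  have key : ∀ q : ℕ, q.Prime → q ∣ orderOf x → q = 2 := by
    intro q hq hdvd
    by_contra hne
    have hpos := orderOf_pos x
    have h1 : orderOf (x ^ (orderOf x / q)) = q := orderOf_pow_orderOf_div hpos.ne' hdvd
    have h2 := h q hq hne _ (hx.pow (orderOf x / q)) 1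
      (by rw [pow_one, ← orderOf_dvd_iff_pow_eq_one, h1])
    rw [h2, orderOf_one] at h1
    exact hq.one_lt.ne h1
  have := Nat.eq_prime_pow_of_unique_prime_dvd (orderOf_pos x).ne'
    (fun {d} hd hdvd => key d hd hdvd)
  rw [← orderOf_dvd_iff_pow_eq_one, this]
  simp [Nat.factorization_pow, Nat.prime_two.factorization_self]

/-- Having no nontrivial real element of odd prime power order passes to quotients by normal
`2`-subgroups. -/
lemma NoOddReal.quotient {H : Type*} [Group H] [Finite H] (h : NoOddReal H) (N : Subgroup H)
    [N.Normal] (hN : IsPGroup 2 N) : NoOddReal (H ⧸ N) := by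
  intro p hp hp2 xb hxb k hk
  have : Fact p.Prime := ⟨hp⟩
  obtain ⟨tb, htb⟩ := hxb
  obtain ⟨x, rfl⟩ := QuotientGroup.mk'_surjective N xb
  obtain ⟨t, rfl⟩ := QuotientGroup.mk'_surjective N tb
  set f := QuotientGroup.mk' N
  set m := orderOf x / p ^ (orderOf x).factorization p
  have hcop : Nat.Coprime p m := Nat.coprime_ordCompl hp (orderOf_pos x).ne'
  set l := (orderOf x).factorization p
  have hxm : (x ^ m) ^ p ^ l = 1 := by
    rw [← pow_mul, mul_comm, Nat.ordProj_mul_ordCompl_eq_self, pow_orderOf_eq_one]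
  have hker : ∀ y ∈ f.ker, ∀ k, y ^ p ^ k = 1 → y = 1 := by
    intro y hy k hk
    rw [QuotientGroup.ker_mk'] at hy
    obtain ⟨j, hj⟩ := hN ⟨y, hy⟩
    have hj' : y ^ 2 ^ j = 1 := by simpa using congrArg Subtype.val hj
    have hc : Nat.Coprime (2 ^ j) (p ^ k) :=
      Nat.Coprime.pow _ _ ((Nat.coprime_primes Nat.prime_two hp).2 hp2.symm)
    rw [← orderOf_eq_one_iff]
    exact Nat.eq_one_of_dvd_coprimes hc (orderOf_dvd_of_pow_eq_one hj')
      (orderOf_dvd_of_pow_eq_one hk)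
  have hb : (t⁻¹ * (x ^ m)⁻¹ * t) ^ p ^ l = 1 := by
    have := conj_pow (i := p ^ l) (a := t⁻¹) (b := (x ^ m)⁻¹)
    rw [inv_inv] at this
    rw [this, inv_pow, hxm]; simp
  have hab : f (x ^ m) = f (t⁻¹ * (x ^ m)⁻¹ * t) := by
    have := conj_pow (i := m) (a := (f t)⁻¹) (b := f x)
    rw [inv_inv, htb] at this
    simp only [map_mul, map_inv, map_pow]
    have h3 : (f t)⁻¹ * (f x ^ m)⁻¹ * f t = ((f t)⁻¹ * f x ^ m * f t)⁻¹ := by group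
    rw [h3, ← this]; simp
  obtain ⟨c, hc⟩ := exists_conj_eq_of_map_eq f hker hxm hb hab
  have hx1 : x ^ m = 1 := by
    refine h p hp hp2 (x ^ m) ⟨t * c⁻¹, ?_⟩ l hxm
    rw [← inv_eq_iff_eq_inv]
    conv_rhs => rw [← hc]
    group
  rw [← orderOf_eq_one_iff]
  refine Nat.eq_one_of_dvd_coprimes (hcop.pow_left k) (orderOf_dvd_of_pow_eq_one hk)
    (orderOf_dvd_of_pow_eq_one ?_)
  rw [← map_pow, hx1, map_one]

/-- A finite group in which `1` is the only real element of odd prime power order has a normal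
`2`-subgroup containing all elements of `2`-power order. -/
lemma NoOddReal.exists_normal_isPGroup_two {H : Type*} [Group H] [Finite H] (h : NoOddReal H) :
    ∃ K : Subgroup H, K.Normal ∧ IsPGroup 2 K ∧ ∀ (g : H) (k : ℕ), g ^ 2 ^ k = 1 → g ∈ K := by
  induction hn : Nat.card H using Nat.strong_induction_on generalizing H with
  | _ n ih =>
    set D : Set H := {t | t ^ 2 = 1} with hDdef
    by_cases hD : ∀ t : H, t ^ 2 = 1 → t = 1
    · refine ⟨⊥, inferInstance, IsPGroup.of_bot, fun g k => ?_⟩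
      rw [mem_bot]
      induction k with
      | zero => simp
      | succ k ihk =>
        intro hg
        rw [pow_succ, pow_mul] at hg
        exact ihk (hD _ hg)
    push Not at hD
    obtain ⟨t, ht, ht1⟩ := hD
    have hmem : ∀ (Q : Sylow 2 H), D ⊆ Q := by
      intro Q s hs
      refine mem_sylow_of_sq_eq_one (fun u v hu hv => ?_) hs Q
      refine h.exists_pow_two_pow_eq_one ⟨u, ?_⟩
      have hui : u⁻¹ = u := inv_eq_of_mul_eq_one_left (by rw [← sq, hu])
      have hvi : v⁻¹ = v := inv_eq_of_mul_eq_one_left (by rw [← sq, hv])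
      rw [mul_inv_rev, hvi, ← mul_assoc, inv_mul_cancel, one_mul, hui]
    have hnorm : (closure D).Normal := by
      rw [← normalizer_eq_top_iff, eq_top_iff]
      refine le_trans (fun g _ => ?_) (normalizer_le_normalizer_closure D)
      intro d
      simp only [hDdef, Set.mem_ofPred_eq, conj_pow, conj_eq_one_iff]
    obtain ⟨Q⟩ : Nonempty (Sylow 2 H) := inferInstance
    have hN : IsPGroup 2 (closure D) := Q.2.to_le ((closure_le _).2 (hmem Q))
    have hlt : Nat.card (H ⧸ closure D) < n := by
      rw [← hn, ← index_eq_card, ← card_mul_index (closure D)]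
      refine lt_mul_of_one_lt_left (Nat.pos_of_ne_zero index_ne_zero_of_finite) ?_
      rw [one_lt_card_iff_ne_bot]
      exact fun hb => ht1 (by rw [← mem_bot, ← hb]; exact subset_closure ht)
    obtain ⟨K, hK, hK2, hKmem⟩ := ih _ hlt (h.quotient _ hN) rfl
    refine ⟨K.comap (QuotientGroup.mk' (closure D)), inferInstance,
      hK2.comap_of_ker_isPGroup _ (by rwa [QuotientGroup.ker_mk']), fun g k hg => ?_⟩
    exact hKmem _ k (by rw [← map_pow, hg, map_one])

lemma NoOddReal.normal_sylow {H : Type*} [Group H] [Finite H] (h : NoOddReal H) (S : Sylow 2 H) :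
    (S : Subgroup H).Normal := by
  obtain ⟨K, hK, hK2, hmem⟩ := h.exists_normal_isPGroup_two
  have hle : (S : Subgroup H) ≤ K := fun s hs => by
    obtain ⟨k, hk⟩ := S.2 ⟨s, hs⟩
    exact hmem s k (by simpa using congrArg Subtype.val hk)
  rwa [← S.3 hK2 hle]

lemma clSize_eq_index {G : Type*} [Group G] [Finite G] (x : G) :
    clSize G x = (centralizer {x}).index := by
  have h := MulAction.index_stabilizer (ConjAct G) x
  rw [ConjAct.stabilizer_eq_centralizer] at h
  have h2 : (centralizer {x}).index = (centralizer {ConjAct.toConjAct x}).index := rfl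
  rw [h2]
  refine Eq.trans ?_ h.symm
  rw [clSize, ← Nat.card_coe_set_eq]
  refine Nat.card_congr (Equiv.subtypeEquivRight fun y => ?_)
  rw [ConjAct.mem_orbit_conjAct, isConj_comm]

lemma two_dvd_clSize {G : Type*} [Group G] [Finite G] {x : G} (hx : IsRealEl G x)
    (hx2 : x ^ 2 ≠ 1) : 2 ∣ clSize G x := by
  classical
  have := Fintype.ofFinite {y : G // IsConj x y}
  have hxinv : IsConj x⁻¹ x := by
    obtain ⟨g, hg⟩ := hx
    exact (isConj_iff.2 ⟨g⁻¹, by rw [inv_inv, hg]⟩).symm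
  have hinv : ∀ y, IsConj x y → IsConj x y⁻¹ := by
    intro y hy
    obtain ⟨c, rfl⟩ := isConj_iff.1 hy
    exact hxinv.symm.trans (isConj_iff.2 ⟨c, by group⟩)
  let σ : Equiv.Perm {y : G // IsConj x y} :=
    { toFun := fun y => ⟨y.1⁻¹, hinv y.1 y.2⟩
      invFun := fun y => ⟨y.1⁻¹, hinv y.1 y.2⟩
      left_inv := fun y => by simp
      right_inv := fun y => by simp }
  by_contra hodd
  rw [clSize, Nat.card_eq_fintype_card] at hodd
  have hσ : σ ^ 2 ^ 1 = 1 := by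
    ext y
    simp [σ, sq]
  obtain ⟨⟨y, hy⟩, hfix⟩ := Equiv.Perm.exists_fixed_point_of_prime hodd hσ
  obtain ⟨c, rfl⟩ := isConj_iff.1 hy
  have hfix' : (c * x * c⁻¹)⁻¹ = c * x * c⁻¹ := congrArg Subtype.val hfix
  have hsq : (c * x * c⁻¹) ^ 2 = 1 := by
    rw [sq]
    nth_rw 1 [← hfix']
    exact inv_mul_cancel _
  rw [conj_pow, conj_eq_one_iff] at hsq
  exact hx2 hsq

/-- If `i` is an involution and no real element of the group has class size divisible by
`2 * |i^G|`, then the only real element of odd prime power order of `C_G(i)` is `1`. -/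
lemma noOddReal_centralizer {G : Type*} [Group G] [Finite G] {i : G} (hi : i ^ 2 = 1)
    (h : ∀ x : G, IsRealEl G x → clSize G i ∣ clSize G x → ¬ 2 ∣ clSize G x) :
    NoOddReal (centralizer {i}) := by
  rintro p hp hp2 ⟨y, hyi⟩ ⟨⟨s, hs⟩, hys⟩ k hk
  have hk' : y ^ p ^ k = 1 := by simpa using congrArg Subtype.val hk
  have hys' : s⁻¹ * y * s = y⁻¹ := by simpa using congrArg Subtype.val hys
  have hcy : Commute i y := (mem_centralizer_singleton_iff.1 hyi).symm
  have hcs : Commute s i := mem_centralizer_singleton_iff.1 hs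
  have hii : i⁻¹ = i := inv_eq_of_mul_eq_one_left (by rw [← sq, hi])
  have hoddp : Odd (p ^ k) := (hp.odd_of_ne_two hp2).pow
  have hreal : IsRealEl G (i * y) := by
    refine ⟨s, ?_⟩
    rw [hcy.mul_inv, hii, ← hys', ← mul_assoc, ← mul_assoc, ← mul_assoc, hcs.inv_left.eq]
  have hpow : (i * y) ^ p ^ k = i := by
    obtain ⟨m, hm⟩ := hoddp
    rw [hcy.mul_pow, hk', mul_one, hm, pow_succ, pow_mul, hi, one_pow, one_mul]
  have hle : centralizer {i * y} ≤ centralizer {i} := by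
    intro g hg
    rw [mem_centralizer_singleton_iff] at hg ⊢
    have hc : Commute g (i * y) := hg
    have := (hc.pow_right (p ^ k)).eq
    rwa [hpow] at this
  have hdvd : clSize G i ∣ clSize G (i * y) := by
    rw [clSize_eq_index, clSize_eq_index]
    exact index_dvd_of_le hle
  have hsq : (i * y) ^ 2 = 1 := by_contra fun hne => h _ hreal hdvd (two_dvd_clSize hreal hne)
  rw [hcy.mul_pow, hi, one_mul] at hsq
  have hcop : Nat.Coprime 2 (p ^ k) := (Nat.coprime_two_left).2 hoddp
  refine Subtype.ext ?_
  rw [coe_one, ← orderOf_eq_one_iff]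
  exact Nat.eq_one_of_dvd_coprimes hcop (orderOf_dvd_of_pow_eq_one hsq)
    (orderOf_dvd_of_pow_eq_one hk')

theorem stmt_14 {G : Type*} [Group G] [Finite G] (π₁ π₂ : Set ℕ)
    (h1 : π₁.Nonempty) (h2 : π₂.Nonempty) (hdisj : Disjoint π₁ π₂)
    (hcover : π₁ ∪ π₂ = realVerts G)
    (hnoedge : ∀ p ∈ π₁, ∀ q ∈ π₂, ¬ realAdj G p q)
    (h2not : 2 ∉ π₂) :
    ∃ i : G, i ^ 2 = 1 ∧ 1 < clSize G i ∧
      (∀ p : ℕ, p.Prime → p ∣ clSize G i → p ∈ π₂) ∧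
      (∀ S : Sylow 2 (Subgroup.centralizer {i}), (S : Subgroup (Subgroup.centralizer {i})).Normal) := by
  obtain ⟨q, hq⟩ := h2
  obtain ⟨hqp, x, hx, hqx⟩ : q ∈ realVerts G := hcover ▸ Set.mem_union_right π₁ hq
  have hq2 : q ≠ 2 := fun h => h2not (h ▸ hq)
  have hadj : ∀ r : ℕ, r.Prime → ∀ z : G, IsRealEl G z → q ∣ clSize G z → r ∣ clSize G z →
      r ∈ π₂ := by
    intro r hr z hz hqz hrz
    have hmem : r ∈ π₁ ∪ π₂ := hcover ▸ ⟨hr, z, hz, hrz⟩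
    refine hmem.resolve_left fun hr1 => ?_
    have hne : r ≠ q := fun h => Set.disjoint_left.1 hdisj hr1 (h ▸ hq)
    exact hnoedge r hr1 q hq ⟨hr, hqp, hne, z, hz,
      ((Nat.coprime_primes hr hqp).2 hne).mul_dvd_of_dvd_of_dvd hrz hqz⟩
  have hodd : ∀ z : G, IsRealEl G z → q ∣ clSize G z → ¬ 2 ∣ clSize G z := fun z hz hqz h =>
    h2not (hadj 2 Nat.prime_two z hz hqz h)
  have hx2 : x ^ 2 = 1 := by_contra fun h => hodd x hx hqx (two_dvd_clSize hx h)
  have hpos : 0 < clSize G x := by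
    rw [clSize_eq_index]
    exact Nat.pos_of_ne_zero index_ne_zero_of_finite
  exact ⟨x, hx2, hqp.one_lt.trans_le (Nat.le_of_dvd hpos hqx),
    fun r hr hrx => hadj r hr x hx hqx hrx,
    fun S => (noOddReal_centralizer hx2 fun z hz hdvd => hodd z hz (hqx.trans hdvd)).normal_sylow S⟩
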